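/- Let f : 𝔽₂ⁿ → 𝔽₂ and define f' : 𝔽₂ⁿ × 𝔽₂¹⁰ → 𝔽₂ by f'(x, y) = f(x) · y₁ · y₂ ⋯ y₁₀. Then the nonlinearity of f' equals the number of satisfying assignments of f: NL(f') = |{x ∈ 𝔽₂ⁿ : f(x) = 1}|. -/

import Mathlib

/-- A product of at least two variables is not an affine function. -/
theorem exists_prod_ne_affine {ι R : Type*} [Fintype ι] [Nontrivial ι] [CommRing R]
    [Nontrivial R] (b : ι → R) (c : R) :
    ∃ y : ι → R, ∏ i, y i ≠ ∑ i, b i * y i + c := by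
  classical
  by_contra! h
  have hc : c = 0 := by
    obtain ⟨i⟩ := (inferInstance : Nonempty ι)
    have h0 := h 0
    rw [Finset.prod_eq_zero (Finset.mem_univ i) rfl] at h0
    simpa using h0.symm
  have hb (i : ι) : b i = 0 := by
    obtain ⟨j, hj⟩ := exists_ne i
    have hi := h (Pi.single i 1)
    rw [Finset.prod_eq_zero (Finset.mem_univ j) (Pi.single_eq_of_ne hj 1)] at hi
    simpa [hc, Pi.single_apply] using hi.symm
  simpa [hb, hc] using h 1

/-- Every affine function disagrees with `(x, y) ↦ f x * ∏ i, y i` at least once above each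
`x` with `f x = 1`. -/
theorem card_eq_one_le_card_ne_affine {α ι R : Type*} [Fintype α] [Fintype ι] [DecidableEq ι]
    [Nontrivial ι] [CommRing R] [Fintype R] [DecidableEq R] [Nontrivial R]
    (f g : α → R) (b : ι → R) (c : R) :
    (Finset.univ.filter (fun x => f x = 1)).card ≤
      (Finset.univ.filter (fun z : α × (ι → R) =>
        ¬ f z.1 * ∏ i, z.2 i = g z.1 + ∑ j, b j * z.2 j + c)).card := by
  choose y hy using fun x => exists_prod_ne_affine b (g x + c)
  refine Finset.card_le_card_of_injOn (fun x => (x, y x)) ?_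
    fun _ _ _ _ h => congrArg Prod.fst h
  intro x hx
  have hfx : f x = 1 := by simpa using hx
  have hne := hy x
  simp only [Finset.coe_filter, Finset.mem_univ, true_and, Set.mem_ofPred_eq, hfx, one_mul]
  intro h
  exact hne (h.trans (by ring))

/-- Over `ZMod 2`, the function `(x, y) ↦ f x * ∏ i, y i` is nonzero at most once above each
`x` with `f x = 1`, and nowhere else. -/
theorem card_mul_prod_ne_zero_le {α ι : Type*} [Fintype α] [Fintype ι] [DecidableEq ι]
    (f : α → ZMod 2) :
    (Finset.univ.filter (fun z : α × (ι → ZMod 2) => ¬ f z.1 * ∏ i, z.2 i = 0)).card ≤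
      (Finset.univ.filter (fun x => f x = 1)).card := by
  have eq_one : ∀ t : ZMod 2, t ≠ 0 → t = 1 := by decide
  have key (z : α × (ι → ZMod 2)) (hz : ¬ f z.1 * ∏ i, z.2 i = 0) :
      f z.1 = 1 ∧ z.2 = 1 := by
    obtain ⟨hf, hp⟩ := mul_ne_zero_iff.1 hz
    exact ⟨eq_one _ hf, funext fun i =>
      eq_one _ (Finset.prod_ne_zero_iff.1 hp i (Finset.mem_univ i))⟩
  refine Finset.card_le_card_of_injOn Prod.fst ?_ ?_
  · intro z hz
    simpa using (key z (Finset.mem_filter.1 hz).2).1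
  · intro z hz w hw h
    exact Prod.ext h ((key z (Finset.mem_filter.1 hz).2).2.trans
      (key w (Finset.mem_filter.1 hw).2).2.symm)

/-- For `f' (x, y) = f x * ∏ i, y i`, the nonlinearity of `f'` (on `n + 10`
variables) equals the number of satisfying assignments of `f`:
`NL(f') = 2^(n+10) - max_{a,b,c} |{z : f' z = a·z.1 + b·z.2 + c}| = |{x : f x = 1}|`. -/
theorem nonlinearity_padded_eq_count_ones (n : ℕ) (f : (Fin n → ZMod 2) → ZMod 2) :
    2 ^ (n + 10)
      - Finset.univ.sup
          (fun abc : ((Fin n → ZMod 2) × (Fin 10 → ZMod 2)) × ZMod 2 =>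
            (Finset.univ.filter
              (fun z : (Fin n → ZMod 2) × (Fin 10 → ZMod 2) =>
                f z.1 * ∏ i, z.2 i
                  = (∑ i, abc.1.1 i * z.1 i) + (∑ j, abc.1.2 j * z.2 j) + abc.2)).card)
      = (Finset.univ.filter (fun x : Fin n → ZMod 2 => f x = 1)).card := by
  have total (p : (Fin n → ZMod 2) × (Fin 10 → ZMod 2) → Prop) [DecidablePred p] :
      (Finset.univ.filter p).card + (Finset.univ.filter (fun z => ¬ p z)).card
        = 2 ^ (n + 10) := by
    rw [Finset.card_filter_add_card_filter_not, Finset.card_univ, Fintype.card_prod,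
      Fintype.card_fun, Fintype.card_fun, ZMod.card, Fintype.card_fin, Fintype.card_fin, pow_add]
  have hzero := total (fun z => f z.1 * ∏ i, z.2 i = 0)
  have hle := card_mul_prod_ne_zero_le (ι := Fin 10) f
  have hge := card_eq_one_le_card_ne_affine (ι := Fin 10) f (fun _ => 0) 0 0
  simp only [Pi.zero_apply, zero_mul, Finset.sum_const_zero, add_zero] at hge
  suffices hsup : Finset.univ.sup _ =
      (Finset.univ.filter (fun z : (Fin n → ZMod 2) × (Fin 10 → ZMod 2) =>
        f z.1 * ∏ i, z.2 i = 0)).card by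
    rw [hsup]
    omega
  apply le_antisymm
  · refine Finset.sup_le fun abc _ => ?_
    have habc := total (fun z => f z.1 * ∏ i, z.2 i
      = (∑ i, abc.1.1 i * z.1 i) + (∑ j, abc.1.2 j * z.2 j) + abc.2)
    have hlow := card_eq_one_le_card_ne_affine f (fun x => ∑ i, abc.1.1 i * x i) abc.1.2 abc.2
    omega
  · refine le_trans (le_of_eq ?_) (Finset.le_sup (Finset.mem_univ 0))
    simp
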